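/- arXiv:1201.3007 — 2 statements merged into one kernel-verified Lean document; each statement's English description precedes it below -/
import Mathlib

section
/- Let n ≥ 2. Let u, φ₃, …, φₙ : ℝⁿ → ℝ be differentiable, fix x ∈ ℝⁿ, and let y : ℝ → ℝⁿ be a differentiable function with y(0) = x satisfying, for all γ ∈ ℝ, y′(γ) = c(y(γ)), where c(z) ∈ ℝⁿ is the generalized cross product of the n − 1 vectors ∇u(z), ∇φ₃(z), …, ∇φₙ(z) in ℝⁿ. Define G(x; γ) = y(γ) − x. Then G(x; 0) = 0 and u(x + G(x; γ)) = u(x) for all γ ∈ ℝ. -/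
open BigOperators

/-- The generalized cross product of `n` vectors in `ℝ^(n+1)`. -/
noncomputable def crossProd {n : ℕ} (v : Fin n → Fin (n + 1) → ℝ) : Fin (n + 1) → ℝ :=
  fun j => (-1 : ℝ) ^ (j : ℕ) * Matrix.det (Matrix.of fun i k => v i (j.succAbove k))

/-- The gradient of `u : ℝⁿ → ℝ`. -/
noncomputable def grad {n : ℕ} (u : (Fin n → ℝ) → ℝ) (z : Fin n → ℝ) : Fin n → ℝ :=
  fun i => fderiv ℝ u z (Pi.single i 1)

/-- The scalar triple product identity: dotting with `crossProd v` prepends a row. -/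
theorem dotProduct_crossProd {n : ℕ} (w : Fin (n + 1) → ℝ) (v : Fin n → Fin (n + 1) → ℝ) :
    w ⬝ᵥ crossProd v = (Matrix.of (Fin.cons w v : Fin (n + 1) → Fin (n + 1) → ℝ)).det := by
  rw [Matrix.det_succ_row_zero]
  refine Finset.sum_congr rfl fun j _ => ?_
  have h : (Matrix.of (Fin.cons w v : Fin (n + 1) → Fin (n + 1) → ℝ)).submatrix Fin.succ
      j.succAbove = Matrix.of fun i k => v i (j.succAbove k) := by
    ext i k
    simp
  rw [h]
  simp only [crossProd, Matrix.of_apply, Fin.cons_zero]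
  ring

/-- The generalized cross product is orthogonal to each of its factors. -/
theorem dotProduct_crossProd_self {n : ℕ} (v : Fin n → Fin (n + 1) → ℝ) (i : Fin n) :
    v i ⬝ᵥ crossProd v = 0 := by
  rw [dotProduct_crossProd]
  refine Matrix.det_zero_of_row_eq (Fin.succ_ne_zero i).symm ?_
  ext j
  simp

theorem fderiv_apply_eq_grad_dotProduct {n : ℕ} (u : (Fin n → ℝ) → ℝ) (z w : Fin n → ℝ) :
    fderiv ℝ u z w = grad u z ⬝ᵥ w := by
  conv_lhs => rw [pi_eq_sum_univ' w]
  simp [grad, dotProduct, mul_comm]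

/-- Part 3 of Theorem 1 (compensation of Poisson jumps), with `n = k + 2 ≥ 2`: if `y`
solves `y′(γ) = c(y(γ))`, where `c(z)` is the generalized cross product of the `n - 1`
gradients `∇u(z), ∇φ₃(z), …, ∇φₙ(z)`, with `y(0) = x`, then `G(x; γ) = y(γ) - x`
satisfies `G(x; 0) = 0` and `u(x + G(x; γ)) = u(x)` for all `γ`. -/
theorem stmt_6 (k : ℕ) (u : (Fin (k + 2) → ℝ) → ℝ)
    (φ : Fin k → (Fin (k + 2) → ℝ) → ℝ)
    (hu : Differentiable ℝ u) (hφ : ∀ i : Fin k, Differentiable ℝ (φ i))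
    (x : Fin (k + 2) → ℝ) (y : ℝ → Fin (k + 2) → ℝ)
    (hy : Differentiable ℝ y) (hy0 : y 0 = x)
    (hode : ∀ γ : ℝ,
      HasDerivAt y (crossProd (Fin.cons (grad u (y γ)) fun i => grad (φ i) (y γ))) γ)
    (G : ℝ → Fin (k + 2) → ℝ) (hG : ∀ γ : ℝ, G γ = y γ - x) :
    G 0 = 0 ∧ ∀ γ : ℝ, u (x + G γ) = u x := by
  have hconst : ∀ γ : ℝ, HasDerivAt (u ∘ y) 0 γ := fun γ => by
    have h := (hu (y γ)).hasFDerivAt.comp_hasDerivAt γ (hode γ)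
    have h_orth := dotProduct_crossProd_self
      (Fin.cons (grad u (y γ)) fun i => grad (φ i) (y γ)) 0
    rw [Fin.cons_zero] at h_orth
    rwa [fderiv_apply_eq_grad_dotProduct, h_orth] at h
  refine ⟨by simp [hG, hy0], fun γ => ?_⟩
  have h := is_const_of_deriv_eq_zero (fun t => (hconst t).differentiableAt)
    (fun t => (hconst t).deriv) γ 0
  simpa [hG, hy0] using h
end

section
/- For all x₁, x₂, γ ∈ ℝ with 2γ + e^{2x₁} > 0, define g₁(x₁, x₂; γ) = (1/2) ln(2γ + e^{2x₁}) − x₁ and g₂(x₁, x₂; γ) = 2 x₂ γ e^{−2x₁}. Then (x₂ + g₂(x₁, x₂; γ)) · e^{−2(x₁ + g₁(x₁, x₂; γ))} = x₂ e^{−2x₁}; that is, u(x + g(x; γ)) = u(x) for u(x₁, x₂) = x₂ e^{−2x₁}. -/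
/-- Compensation of Poisson jumps in the worked example: for
`u(x₁, x₂) = x₂ e^{-2x₁}` and the jump response
`g₁ = (1/2) ln(2γ + e^{2x₁}) - x₁`, `g₂ = 2x₂γe^{-2x₁}`, one has
`u(x + g(x; γ)) = u(x)`. -/
theorem stmt_9 (x₁ x₂ γ : ℝ) (h : 2 * γ + Real.exp (2 * x₁) > 0)
    (g₁ g₂ : ℝ)
    (hg₁ : g₁ = (1 / 2) * Real.log (2 * γ + Real.exp (2 * x₁)) - x₁)
    (hg₂ : g₂ = 2 * x₂ * γ * Real.exp (-2 * x₁)) :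
    (x₂ + g₂) * Real.exp (-2 * (x₁ + g₁)) = x₂ * Real.exp (-2 * x₁) := by
  have hexp : Real.exp (-2 * (x₁ + g₁)) = (2 * γ + Real.exp (2 * x₁))⁻¹ := by
    rw [hg₁, show -2 * (x₁ + ((1 / 2) * Real.log (2 * γ + Real.exp (2 * x₁)) - x₁))
      = -Real.log (2 * γ + Real.exp (2 * x₁)) by ring, Real.exp_neg, Real.exp_log h]
  have hinv : Real.exp (-2 * x₁) = (Real.exp (2 * x₁))⁻¹ := by
    rw [← Real.exp_neg, neg_mul]
  have hpos := Real.exp_pos (2 * x₁)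
  rw [hexp, hg₂, hinv]
  field_simp
  ring
end
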